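/- There are exactly (q+1)³·q³ cyclic submodules of ²T₃(q) generated by unimodular pairs; that is, the projective line over T₃(q) has exactly (q+1)³q³ points. -/

import Mathlib

open Matrix

/-- `Mat n F` is the type of `n × n` matrices over `F`. -/
abbrev Mat (n : ℕ) (F : Type) : Type := Matrix (Fin n) (Fin n) F

/-- A matrix is lower triangular (i.e. belongs to the ring `T_n(q)`)
if all entries above the diagonal vanish. -/
def LowerTri {n : ℕ} {F : Type} [Zero F] (X : Mat n F) : Prop :=
  ∀ i j : Fin n, i < j → X i j = 0

/-- The cyclic left submodule `T_n(q)(X,Y)` of `²T_n(q)` generated by the pair `(X,Y)`. -/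
def cyc {n : ℕ} {F : Type} [Field F] (X Y : Mat n F) : Set (Mat n F × Mat n F) :=
  {p | ∃ A : Mat n F, LowerTri A ∧ p = (A * X, A * Y)}

/-- The pair `(X,Y)` generates a *free* cyclic submodule:
`A • (X,Y) = (0,0)` with `A ∈ T_n(q)` forces `A = 0`. -/
def IsFreePair {n : ℕ} {F : Type} [Field F] (X Y : Mat n F) : Prop :=
  ∀ A : Mat n F, LowerTri A → A * X = 0 → A * Y = 0 → A = 0

/-- A pair `(X,Y)` is unimodular if for every index `i` one of the `i`-th
diagonal entries of `X`, `Y` is nonzero. -/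
def Unimodular {n : ℕ} {F : Type} [Field F] (X Y : Mat n F) : Prop :=
  ∀ i : Fin n, X i i ≠ 0 ∨ Y i i ≠ 0

/-- `M` is a free cyclic submodule of `²T_n(q)`. -/
def IsFreeCyc {n : ℕ} {F : Type} [Field F] (M : Set (Mat n F × Mat n F)) : Prop :=
  ∃ X Y : Mat n F, LowerTri X ∧ LowerTri Y ∧ IsFreePair X Y ∧ M = cyc X Y

/-- `M` is a free cyclic submodule of `²T_n(q)` generated by a non-unimodular pair. -/
def IsNonUnimodFreeCyc {n : ℕ} {F : Type} [Field F] (M : Set (Mat n F × Mat n F)) : Prop :=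
  ∃ X Y : Mat n F, LowerTri X ∧ LowerTri Y ∧ ¬ Unimodular X Y ∧ IsFreePair X Y ∧ M = cyc X Y

namespace LowerTri

variable {n : ℕ} {F : Type} [Field F] {A X : Mat n F}

theorem one : LowerTri (1 : Mat n F) := fun _ _ h => Matrix.one_apply_ne h.ne

theorem mul (hA : LowerTri A) (hX : LowerTri X) : LowerTri (A * X) :=
  BlockTriangular.mul (b := OrderDual.toDual) (fun _ _ h => hA _ _ h) (fun _ _ h => hX _ _ h)

theorem mul_apply_self (hA : LowerTri A) (hX : LowerTri X) (i : Fin n) :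
    (A * X) i i = A i i * X i i := by
  rw [Matrix.mul_apply]
  refine Finset.sum_eq_single i (fun k _ hk => ?_) (by simp)
  rcases lt_or_gt_of_ne hk with h | h
  · rw [hX _ _ h, mul_zero]
  · rw [hA _ _ h, zero_mul]

theorem isUnit_det (hA : LowerTri A) (h : ∀ i, A i i ≠ 0) : IsUnit A.det := by
  rw [det_of_isLowerTriangular A fun _ _ h => hA _ _ h]
  exact (Finset.prod_ne_zero_iff.mpr fun i _ => h i).isUnit

theorem inv (hA : LowerTri A) (h : IsUnit A.det) : LowerTri A⁻¹ := by
  have := A.invertibleOfIsUnitDet h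
  have hA' : BlockTriangular A OrderDual.toDual := fun _ _ h => hA _ _ h
  exact fun i j hij => blockTriangular_inv_of_blockTriangular hA' hij

end LowerTri

section SelectCols

variable {n : ℕ} {F : Type}

/-- The matrix whose `j`-th column is taken from `X` if `s j` holds and from `Y` otherwise. -/
def selectCols (s : Fin n → Bool) (X Y : Mat n F) : Mat n F :=
  Matrix.of fun i j => if s j then X i j else Y i j

theorem selectCols_apply (s : Fin n → Bool) (X Y : Mat n F) (i j : Fin n) :
    selectCols s X Y i j = if s j then X i j else Y i j := rfl

theorem selectCols_selectCols (s : Fin n → Bool) (X Y : Mat n F) :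
    selectCols s (selectCols s X Y) (selectCols s Y X) = X := by
  ext i j
  simp only [selectCols_apply]
  split_ifs <;> rfl

end SelectCols

section Cyclic

variable {n : ℕ} {F : Type} [Field F]

theorem mem_cyc_self (X Y : Mat n F) : (X, Y) ∈ cyc X Y := ⟨1, .one, by simp⟩

theorem cyc_mul_subset {A : Mat n F} (hA : LowerTri A) (X Y : Mat n F) :
    cyc (A * X) (A * Y) ⊆ cyc X Y := by
  rintro _ ⟨B, hB, rfl⟩
  exact ⟨B * A, hB.mul hA, by simp [Matrix.mul_assoc]⟩

theorem cyc_inv_mul {A : Mat n F} (hA : LowerTri A) (h : IsUnit A.det) (X Y : Mat n F) :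
    cyc (A⁻¹ * X) (A⁻¹ * Y) = cyc X Y := by
  refine (cyc_mul_subset (hA.inv h) X Y).antisymm ?_
  simpa only [mul_nonsing_inv_cancel_left A _ h] using cyc_mul_subset hA (A⁻¹ * X) (A⁻¹ * Y)

theorem LowerTri.selectCols {X Y : Mat n F} (hX : LowerTri X) (hY : LowerTri Y)
    (s : Fin n → Bool) : LowerTri (selectCols s X Y) := by
  intro i j h
  simp [selectCols_apply, hX i j h, hY i j h]

theorem mul_selectCols (s : Fin n → Bool) (A X Y : Mat n F) :
    A * selectCols s X Y = selectCols s (A * X) (A * Y) := by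
  ext i j
  simp only [Matrix.mul_apply, selectCols_apply]
  split_ifs <;> rfl

/-- The lower triangular matrix with diagonal entries `p i`, read as `0` where undefined, and
with entries `c` below the diagonal. -/
def freeEntries (p : Fin n → Option F) (c : {k : Fin n × Fin n // k.2 < k.1} → F) : Mat n F :=
  Matrix.of fun i j => if h : j < i then c ⟨(i, j), h⟩ else if i = j then (p j).getD 0 else 0

theorem freeEntries_apply_self (p : Fin n → Option F)
    (c : {k : Fin n × Fin n // k.2 < k.1} → F) (i : Fin n) :
    freeEntries p c i i = (p i).getD 0 := by
  simp [freeEntries]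

theorem freeEntries_apply_of_lt (p : Fin n → Option F)
    (c : {k : Fin n × Fin n // k.2 < k.1} → F) (k : {k : Fin n × Fin n // k.2 < k.1}) :
    freeEntries p c k.1.1 k.1.2 = c k := by
  simp [freeEntries, k.2]

theorem lowerTri_freeEntries (p : Fin n → Option F)
    (c : {k : Fin n × Fin n // k.2 < k.1} → F) : LowerTri (freeEntries p c) := by
  intro i j h
  simp [freeEntries, h.not_gt, h.ne]

/-- The point of the projective line with the given normal form: `p j` is the point
`(1, c)` or `(0, 1)` of the projective line over `F` on the `j`-th diagonal entries. -/
def normalPoint (x : (Fin n → Option F) × ({k : Fin n × Fin n // k.2 < k.1} → F)) :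
    Set (Mat n F × Mat n F) :=
  cyc (selectCols (fun j => (x.1 j).isSome) 1 (freeEntries x.1 x.2))
    (selectCols (fun j => (x.1 j).isSome) (freeEntries x.1 x.2) 1)

theorem diag_ne_zero_of_mem_cyc {X Y X' Y' : Mat n F} (hX : LowerTri X)
    (h : (X', Y') ∈ cyc X Y) {i : Fin n} (hi : X' i i ≠ 0) : X i i ≠ 0 := by
  obtain ⟨A, hA, h⟩ := h
  rw [(Prod.mk.inj h).1, hA.mul_apply_self hX] at hi
  exact right_ne_zero_of_mul hi

theorem selectCols_diag_ne_zero_iff (p : Fin n → Option F)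
    (c : {k : Fin n × Fin n // k.2 < k.1} → F) (i : Fin n) :
    selectCols (fun j => (p j).isSome) 1 (freeEntries p c) i i ≠ 0 ↔ (p i).isSome := by
  cases h : p i <;> simp [selectCols_apply, freeEntries_apply_self, h]

theorem normalPoint_injective : Function.Injective (normalPoint (n := n) (F := F)) := by
  rintro ⟨p, c⟩ ⟨p', c'⟩ h
  have hW := lowerTri_freeEntries p c
  have hW' := lowerTri_freeEntries p' c'
  simp only [normalPoint] at h
  have hmem := h ▸ mem_cyc_self (selectCols (fun j => (p j).isSome) 1 (freeEntries p c))
    (selectCols (fun j => (p j).isSome) (freeEntries p c) 1)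
  have hmem' := h.symm ▸ mem_cyc_self
    (selectCols (fun j => (p' j).isSome) 1 (freeEntries p' c'))
    (selectCols (fun j => (p' j).isSome) (freeEntries p' c') 1)
  have hs : (fun j => (p j).isSome) = fun j => (p' j).isSome := by
    funext i
    rw [Bool.eq_iff_iff, ← selectCols_diag_ne_zero_iff p c, ← selectCols_diag_ne_zero_iff p' c']
    exact ⟨diag_ne_zero_of_mem_cyc (LowerTri.one.selectCols hW' _) hmem,
      diag_ne_zero_of_mem_cyc (LowerTri.one.selectCols hW _) hmem'⟩
  obtain ⟨A, -, hA⟩ := hmem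
  rw [Prod.mk.injEq, hs] at hA
  have hA1 : A = 1 := by
    have := mul_selectCols (fun j => (p' j).isSome) A
      (selectCols (fun j => (p' j).isSome) 1 (freeEntries p' c'))
      (selectCols (fun j => (p' j).isSome) (freeEntries p' c') 1)
    rwa [← hA.1, ← hA.2, selectCols_selectCols, selectCols_selectCols, Matrix.mul_one] at this
  have hWW : freeEntries p c = freeEntries p' c' := by
    rw [hA1, Matrix.one_mul, Matrix.one_mul] at hA
    rw [← selectCols_selectCols (fun j => (p' j).isSome) (freeEntries p c) 1, hA.1, hA.2,
      selectCols_selectCols]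
  refine Prod.ext (funext fun i => ?_) (funext fun k => ?_)
  · have hi := congrFun hs i
    have hd := congrFun₂ hWW i i
    simp only [freeEntries_apply_self] at hd
    cases h₁ : p i <;> cases h₂ : p' i <;> simp_all
  · simpa only [freeEntries_apply_of_lt] using congrFun₂ hWW k.1.1 k.1.2

theorem exists_normalPoint_eq_cyc {X Y : Mat n F} (hX : LowerTri X) (hY : LowerTri Y)
    (hU : Unimodular X Y) : ∃ x, normalPoint x = cyc X Y := by
  classical
  set s : Fin n → Bool := fun j => decide (X j j ≠ 0) with hs
  set S := selectCols s X Y with hS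
  set W := selectCols s Y X with hW
  have hSl : LowerTri S := hX.selectCols hY s
  have hWl : LowerTri W := hY.selectCols hX s
  have hdet : IsUnit S.det := hSl.isUnit_det fun i => by
    by_cases h : X i i = 0
    · simpa [hS, hs, selectCols_apply, h] using hU i
    · simp [hS, hs, selectCols_apply, h]
  have hVl : LowerTri (S⁻¹ * W) := (hSl.inv hdet).mul hWl
  refine ⟨(fun j => if s j then some ((S⁻¹ * W) j j) else none,
    fun k => (S⁻¹ * W) k.1.1 k.1.2), ?_⟩
  have hfree : freeEntries (fun j => if s j then some ((S⁻¹ * W) j j) else none)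
      (fun k => (S⁻¹ * W) k.1.1 k.1.2) = S⁻¹ * W := by
    ext i j
    rcases lt_trichotomy i j with h | rfl | h
    · rw [lowerTri_freeEntries _ _ _ _ h, hVl _ _ h]
    · rw [freeEntries_apply_self]
      by_cases hi : s i
      · simp [hi]
      · have hi' : X i i = 0 := by simpa [hs] using hi
        rw [(hSl.inv hdet).mul_apply_self hWl]
        simp [hW, hi, hi', selectCols_apply]
    · exact freeEntries_apply_of_lt _ _ ⟨(i, j), h⟩
  have hsome : (fun j => (if s j then some ((S⁻¹ * W) j j) else none).isSome) = s := by
    funext j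
    cases s j <;> rfl
  simp only [normalPoint]
  rw [hfree, hsome, ← cyc_inv_mul hSl hdet X Y, ← Matrix.nonsing_inv_mul S hdet,
    ← mul_selectCols, ← mul_selectCols, hS, hW, selectCols_selectCols, selectCols_selectCols]

theorem range_normalPoint : Set.range (normalPoint (n := n) (F := F)) =
    {M | ∃ X Y : Mat n F, LowerTri X ∧ LowerTri Y ∧ Unimodular X Y ∧ M = cyc X Y} := by
  ext M
  constructor
  · rintro ⟨⟨p, c⟩, rfl⟩
    have hW := lowerTri_freeEntries p c
    refine ⟨_, _, LowerTri.one.selectCols hW _, hW.selectCols .one _, fun i => ?_, rfl⟩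
    cases h : p i <;> simp [selectCols_apply, h]
  · rintro ⟨X, Y, hX, hY, hU, rfl⟩
    exact exists_normalPoint_eq_cyc hX hY hU

end Cyclic

theorem stmt_16 (q : ℕ) (hq : 2 ≤ q)
    (F : Type) [Field F] [Fintype F] (hF : Fintype.card F = q) :
    Set.ncard {M : Set (Mat 3 F × Mat 3 F) |
        ∃ X Y : Mat 3 F, LowerTri X ∧ LowerTri Y ∧ Unimodular X Y ∧ M = cyc X Y}
      = (q + 1) ^ 3 * q ^ 3 := by
  have hpairs : Fintype.card {k : Fin 3 × Fin 3 // k.2 < k.1} = 3 := by decide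
  rw [← range_normalPoint, ← Nat.card_coe_set_eq,
    Nat.card_range_of_injective normalPoint_injective]
  simp [Nat.card_eq_fintype_card, hF, hpairs]
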